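/- Let A : Matrix (Fin m) (Fin n) ℤ with a bouquet decomposition c_1, …, c_s and bouquet matrix A_B. Assume ker_ℤ(A) contains no nonzero componentwise-nonnegative vector, assume each c_i either is componentwise nonnegative or has both a positive and a negative coordinate, and let S := {i ∈ Fin s | c_i has both a positive and a negative coordinate}. Then the following are equivalent: (a) no element u of the Graver basis Gr(A_B) admits a proper semiconformal decomposition u = v + w in ker_ℤ(A_B) with v_i · w_i ≥ 0 for every i ∈ S; (c) A_B is S-Lawrence, i.e., for every u ∈ Gr(A_B) there is no w : Fin s → ℤ with w ≥ 0 componentwise, A_B.mulVec w = A_B.mulVec u⁺, w ≠ u⁺, w ≠ u⁻, and w_i ≤ max(u⁺_i, u⁻_i) for every i ∈ S. -/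

import Mathlib

/-- The integer kernel of an integer matrix. -/
def kerZ {m n : ℕ} (A : Matrix (Fin m) (Fin n) ℤ) : Set (Fin n → ℤ) :=
  {u | A.mulVec u = 0}

/-- The componentwise positive part `u⁺` of an integer vector. -/
def posPartZ {n : ℕ} (u : Fin n → ℤ) : Fin n → ℤ := fun i => max (u i) 0

/-- The componentwise negative part `u⁻` of an integer vector. -/
def negPartZ {n : ℕ} (u : Fin n → ℤ) : Fin n → ℤ := fun i => max (-u i) 0

/-- `u = v + w` is a proper conformal decomposition within `kerZ A`. -/
def IsProperConformalDecomp {m n : ℕ} (A : Matrix (Fin m) (Fin n) ℤ)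
    (u v w : Fin n → ℤ) : Prop :=
  v ∈ kerZ A ∧ w ∈ kerZ A ∧ v ≠ 0 ∧ w ≠ 0 ∧ u = v + w ∧
    posPartZ u = posPartZ v + posPartZ w ∧ negPartZ u = negPartZ v + negPartZ w

/-- `u` belongs to the Graver basis of `A`: it is a nonzero element of the integer
kernel admitting no proper conformal decomposition. -/
def InGraver {m n : ℕ} (A : Matrix (Fin m) (Fin n) ℤ) (u : Fin n → ℤ) : Prop :=
  u ∈ kerZ A ∧ u ≠ 0 ∧ ¬ ∃ v w, IsProperConformalDecomp A u v w

/-- `u = v + w` is a proper semiconformal decomposition within `kerZ A`. -/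
def IsProperSemiconformalDecomp {m n : ℕ} (A : Matrix (Fin m) (Fin n) ℤ)
    (u v w : Fin n → ℤ) : Prop :=
  v ∈ kerZ A ∧ w ∈ kerZ A ∧ v ≠ 0 ∧ w ≠ 0 ∧ u = v + w ∧
    ∀ i, (0 < v i → 0 ≤ w i) ∧ (w i < 0 → v i ≤ 0)

/-- `c 0, …, c (s-1)` is a bouquet decomposition of `A`: the supports are nonempty,
pairwise disjoint and cover `Fin n`, and every integer kernel element of `A` is,
on the support of each `c i`, an integer multiple of `c i`. -/
def IsBouquetDecomposition {m n s : ℕ} (A : Matrix (Fin m) (Fin n) ℤ)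
    (c : Fin s → Fin n → ℤ) : Prop :=
  (∀ i, (Function.support (c i)).Nonempty) ∧
  (∀ i i', i ≠ i' → Disjoint (Function.support (c i)) (Function.support (c i'))) ∧
  (∀ j, ∃ i, c i j ≠ 0) ∧
  (∀ v ∈ kerZ A, ∀ i, ∃ t : ℤ, ∀ j ∈ Function.support (c i), v j = t * c i j)

/-- The bouquet matrix `A_B`, whose `i`-th column is `A.mulVec (c i)`. -/
def bouquetMatrix {m n s : ℕ} (A : Matrix (Fin m) (Fin n) ℤ)
    (c : Fin s → Fin n → ℤ) : Matrix (Fin m) (Fin s) ℤ :=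
  Matrix.of fun k i => A.mulVec (c i) k

/-- The map `B(u) = Σ_i u_i • c_i`. -/
def Bmap {n s : ℕ} (c : Fin s → Fin n → ℤ) (u : Fin s → ℤ) : Fin n → ℤ :=
  ∑ i, u i • c i

theorem bouquet_condition_iff_S_Lawrence {m n s : ℕ}
    (A : Matrix (Fin m) (Fin n) ℤ) (c : Fin s → Fin n → ℤ)
    (hc : IsBouquetDecomposition A c)
    (hpos : ¬ ∃ v ∈ kerZ A, v ≠ 0 ∧ ∀ j, 0 ≤ v j)
    (hsign : ∀ i, (∀ j, 0 ≤ c i j) ∨ ((∃ j, 0 < c i j) ∧ (∃ j, c i j < 0)))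
    (S : Set (Fin s))
    (hS : S = {i | (∃ j, 0 < c i j) ∧ (∃ j, c i j < 0)}) :
    (¬ ∃ u v w : Fin s → ℤ, InGraver (bouquetMatrix A c) u ∧
        IsProperSemiconformalDecomp (bouquetMatrix A c) u v w ∧
        ∀ i ∈ S, 0 ≤ v i * w i) ↔
      (∀ u : Fin s → ℤ, InGraver (bouquetMatrix A c) u →
        ¬ ∃ w : Fin s → ℤ, (∀ i, 0 ≤ w i) ∧
          (bouquetMatrix A c).mulVec w = (bouquetMatrix A c).mulVec (posPartZ u) ∧
          w ≠ posPartZ u ∧ w ≠ negPartZ u ∧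
          ∀ i ∈ S, w i ≤ max (posPartZ u i) (negPartZ u i)) := by
  have hsub : ∀ (u : Fin s → ℤ), u = posPartZ u - negPartZ u := by
    intro u
    funext i
    simp only [posPartZ, negPartZ, Pi.sub_apply]
    omega
  constructor
  · rintro h u hu ⟨z, hz0, hzM, hz1, hz2, hzS⟩
    apply h
    have hker : (bouquetMatrix A c).mulVec u = 0 := hu.1
    have hnp : (bouquetMatrix A c).mulVec (posPartZ u)
        = (bouquetMatrix A c).mulVec (negPartZ u) := by
      have h1 := hker
      rw [hsub u, Matrix.mulVec_sub] at h1
      exact sub_eq_zero.mp h1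
    refine ⟨u, posPartZ u - z, z - negPartZ u, hu, ⟨?_, ?_, ?_, ?_, ?_, ?_⟩, ?_⟩
    · change (bouquetMatrix A c).mulVec _ = 0
      rw [Matrix.mulVec_sub, hzM, sub_self]
    · change (bouquetMatrix A c).mulVec _ = 0
      rw [Matrix.mulVec_sub, hzM, hnp, sub_self]
    · exact fun h0 => hz1 (sub_eq_zero.mp h0).symm
    · exact fun h0 => hz2 (sub_eq_zero.mp h0)
    · rw [sub_add_sub_cancel]
      exact hsub u
    · intro i
      have := hz0 i
      simp only [posPartZ, negPartZ, Pi.sub_apply]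
      constructor <;> intro <;> omega
    · intro i hi
      have h0 := hz0 i
      have h1 := hzS i hi
      simp only [posPartZ, negPartZ, Pi.sub_apply] at h1 ⊢
      rcases le_total 0 (u i) with hu0 | hu0
      · apply mul_nonneg <;> omega
      · apply mul_nonneg_of_nonpos_of_nonpos <;> omega
  · rintro h ⟨u, v, w, hu, ⟨hv, hw, hv0, hw0, huvw, hsc⟩, hS'⟩
    refine h u hu ⟨posPartZ u - v, ?_, ?_, ?_, ?_, ?_⟩
    · intro i
      have h1 := hsc i
      have h2 : u i = v i + w i := congrFun huvw i
      simp only [posPartZ, Pi.sub_apply]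
      omega
    · have hv' : (bouquetMatrix A c).mulVec v = 0 := hv
      rw [Matrix.mulVec_sub, hv', sub_zero]
    · intro h0
      exact hv0 (sub_eq_self.mp h0)
    · intro h0
      apply hw0
      funext i
      have h1 := congrFun h0 i
      have h2 : u i = v i + w i := congrFun huvw i
      simp only [posPartZ, negPartZ, Pi.sub_apply, Pi.zero_apply] at h1 ⊢
      omega
    · intro i hi
      have h2 : u i = v i + w i := congrFun huvw i
      have h3 := hS' i hi
      simp only [posPartZ, negPartZ, Pi.sub_apply]
      rcases mul_nonneg_iff.mp h3 with h4 | h4 <;> omega
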